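/- Let a ∈ ℝ^N have all entries positive, with M = max(a_1, …, a_N) and m = min(a_1, …, a_N). Let X, Y ∈ ℝ^N be orthonormal with respect to the Euclidean inner product and let λ, μ ∈ ℝ satisfy λ² + μ² = 1. Define κ = −λ² Σ_{i=1}^N a_i² Y_i² − μ² Σ_{1 ≤ i < j ≤ N} a_i a_j ( X_i Y_j − X_j Y_i )². Then −M² ≤ κ ≤ −m². -/

import Mathlib

/-- A sum over ordered pairs of a symmetric function vanishing on the diagonal is twice the sum
over the pairs `i < j`. -/
theorem sum_sum_eq_two_mul_sum_filter_lt {ι : Type*} [Fintype ι] [LinearOrder ι]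
    (f : ι → ι → ℝ) (hsymm : ∀ i j, f i j = f j i) (hdiag : ∀ i, f i i = 0) :
    ∑ i, ∑ j, f i j =
      2 * ∑ p ∈ Finset.univ.filter (fun p : ι × ι => p.1 < p.2), f p.1 p.2 := by
  have hlt : ∑ p ∈ Finset.univ.filter (fun p : ι × ι => p.1 < p.2), f p.1 p.2 =
      ∑ i, ∑ j, if i < j then f i j else 0 := by
    rw [Finset.sum_filter, Fintype.sum_prod_type]
  have hgt : ∑ p ∈ Finset.univ.filter (fun p : ι × ι => p.1 < p.2), f p.1 p.2 =
      ∑ i, ∑ j, if j < i then f i j else 0 := by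
    rw [hlt, Finset.sum_comm]
    simp_rw [hsymm]
  rw [two_mul]
  nth_rewrite 1 [hlt]
  rw [hgt]
  simp_rw [← Finset.sum_add_distrib]
  refine Finset.sum_congr rfl fun i _ => Finset.sum_congr rfl fun j _ => ?_
  rcases lt_trichotomy i j with h | rfl | h
  · simp [h, h.not_gt]
  · simp [hdiag]
  · simp [h, h.not_gt]

/-- **Lagrange's identity.** -/
theorem sum_filter_lt_sq_eq {ι : Type*} [Fintype ι] [LinearOrder ι] (X Y : ι → ℝ) :
    ∑ p ∈ Finset.univ.filter (fun p : ι × ι => p.1 < p.2),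
        (X p.1 * Y p.2 - X p.2 * Y p.1) ^ 2 =
      (∑ i, X i ^ 2) * (∑ i, Y i ^ 2) - (∑ i, X i * Y i) ^ 2 := by
  have hdouble := sum_sum_eq_two_mul_sum_filter_lt
    (fun i j => (X i * Y j - X j * Y i) ^ 2) (fun i j => by ring) (fun i => by ring)
  have hexpand : ∑ i, ∑ j, (X i * Y j - X j * Y i) ^ 2 =
      (∑ i, X i ^ 2) * (∑ i, Y i ^ 2) + (∑ i, Y i ^ 2) * (∑ i, X i ^ 2) -
        2 * ((∑ i, X i * Y i) * ∑ i, X i * Y i) := by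
    simp_rw [Finset.sum_mul_sum, Finset.mul_sum, ← Finset.sum_add_distrib,
      ← Finset.sum_sub_distrib]
    refine Finset.sum_congr rfl fun i _ => Finset.sum_congr rfl fun j _ => ?_
    ring
  linarith

/-- A weighted sum with nonnegative weights of total mass one lies between any bounds on the
averaged values. -/
theorem weighted_sum_mem_Icc {ι : Type*} {s : Finset ι} {c w : ι → ℝ} {l u : ℝ}
    (hw : ∀ i ∈ s, 0 ≤ w i) (hsum : ∑ i ∈ s, w i = 1) (hc : ∀ i ∈ s, c i ∈ Set.Icc l u) :
    ∑ i ∈ s, c i * w i ∈ Set.Icc l u := by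
  simpa only [smul_eq_mul, mul_comm] using (convex_Icc l u).sum_mem hw hsum hc


/-- **Curvature bounds, definite case.** Let `a ∈ ℝ^N` have positive entries with maximum `M`
and minimum `m`, let `X, Y ∈ ℝ^N` be orthonormal, and let `λ² + μ² = 1`. Then the sectional
curvature `κ = −λ² ∑ aᵢ² Yᵢ² − μ² ∑_{i<j} aᵢ aⱼ (Xᵢ Yⱼ − Xⱼ Yᵢ)²` satisfies `−M² ≤ κ ≤ −m²`. -/
theorem curvature_bounds_positive_case {N : ℕ} (a X Y : Fin N → ℝ) (M m : ℝ)
    (ha : ∀ i, 0 < a i)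
    (hM : IsGreatest (Set.range a) M) (hm : IsLeast (Set.range a) m)
    (hX : ∑ i, X i ^ 2 = 1) (hY : ∑ i, Y i ^ 2 = 1) (hXY : ∑ i, X i * Y i = 0)
    (lam mu : ℝ) (hlm : lam ^ 2 + mu ^ 2 = 1) :
    -M ^ 2 ≤ -(lam ^ 2) * (∑ i, (a i) ^ 2 * Y i ^ 2) -
        mu ^ 2 * ∑ p ∈ Finset.univ.filter (fun p : Fin N × Fin N => p.1 < p.2),
          a p.1 * a p.2 * (X p.1 * Y p.2 - X p.2 * Y p.1) ^ 2 ∧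
      -(lam ^ 2) * (∑ i, (a i) ^ 2 * Y i ^ 2) -
        mu ^ 2 * ∑ p ∈ Finset.univ.filter (fun p : Fin N × Fin N => p.1 < p.2),
          a p.1 * a p.2 * (X p.1 * Y p.2 - X p.2 * Y p.1) ^ 2 ≤ -m ^ 2 := by
  have hMa : ∀ i, a i ≤ M := fun i => hM.2 ⟨i, rfl⟩
  have hma : ∀ i, m ≤ a i := fun i => hm.2 ⟨i, rfl⟩
  have hm0 : 0 < m := by
    obtain ⟨i, rfl⟩ := hm.1
    exact ha i
  have hprod : ∀ i j, a i * a j ∈ Set.Icc (m ^ 2) (M ^ 2) := fun i j => by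
    rw [sq, sq]
    exact ⟨mul_le_mul (hma i) (hma j) hm0.le (ha i).le,
      mul_le_mul (hMa i) (hMa j) (ha j).le ((ha i).le.trans (hMa i))⟩
  have hA : ∑ i, (a i) ^ 2 * Y i ^ 2 ∈ Set.Icc (m ^ 2) (M ^ 2) :=
    weighted_sum_mem_Icc (fun i _ => sq_nonneg _) hY fun i _ => by
      simpa only [sq (a i)] using hprod i i
  have hB : ∑ p ∈ Finset.univ.filter (fun p : Fin N × Fin N => p.1 < p.2),
      a p.1 * a p.2 * (X p.1 * Y p.2 - X p.2 * Y p.1) ^ 2 ∈ Set.Icc (m ^ 2) (M ^ 2) :=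
    weighted_sum_mem_Icc (fun p _ => sq_nonneg _)
      (by rw [sum_filter_lt_sq_eq, hX, hY, hXY]; norm_num) fun p _ => hprod p.1 p.2
  have hcomb := convex_Icc (m ^ 2) (M ^ 2) hA hB (sq_nonneg lam) (sq_nonneg mu) hlm
  simp only [smul_eq_mul, Set.mem_Icc] at hcomb
  constructor <;> linarith [hcomb.1, hcomb.2]
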